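/- Suppose w(S) = m(|S|) for a nondecreasing function m : {0,1,…,n} → ℝ̄ (so p_w is symmetric). Then for every y ∈ ℝ̄, 1 − F_Y(y) = Σ_{s=0}^n Ind(m(s) > y) · ℙ(#{i ∈ {1,…,n} : X_i > y} = s). -/

import Mathlib

open MeasureTheory Finset

/-- The weighted lattice polynomial exceeds `y` exactly when the weight of the set of coordinates
exceeding `y` does. -/
theorem lt_iSup_inf_iInf_iff {ι : Type*} [Fintype ι] {w : Finset ι → EReal} (hw : Monotone w)
    (x : ι → EReal) (y : EReal) :
    y < (⨆ S : Finset ι, (w S ⊓ ⨅ i ∈ S, x i)) ↔ y < w (univ.filter fun i => x i > y) := by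
  rw [lt_iSup_iff]
  constructor
  · rintro ⟨S, hS⟩
    rw [lt_inf_iff] at hS
    refine hS.1.trans_le (hw fun i hi => ?_)
    simpa using hS.2.trans_le (iInf₂_le i hi)
  · intro h
    refine ⟨_, lt_inf_iff.2 ⟨h, ?_⟩⟩
    rw [← Finset.inf_eq_iInf, Finset.lt_inf_iff (h.trans_le le_top)]
    simp

theorem measurable_card_filter_gt {ι Ω : Type*} [Fintype ι] [MeasurableSpace Ω]
    {X : ι → Ω → EReal} (hX : ∀ i, Measurable (X i)) (y : EReal) :
    Measurable fun ω => (univ.filter fun i => X i ω > y).card := by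
  simp only [Finset.card_filter]
  exact Finset.measurable_sum _ fun i _ =>
    Measurable.ite (measurableSet_lt measurable_const (hX i)) measurable_const measurable_const

/-- if `w S = m |S|` for nondecreasing `m` (so `p_w` is symmetric), then
`1 − F_Y(y) = Σ_{s=0}^n Ind(m s > y) · ℙ(#{i : X_i > y} = s)`. -/
theorem stmt_10 {n : ℕ} (hn : 1 ≤ n) {Ω : Type*} [MeasurableSpace Ω]
    (ℙ : Measure Ω) [IsProbabilityMeasure ℙ]
    (X : Fin n → Ω → EReal) (hX : ∀ i, Measurable (X i))
    (w : Finset (Fin n) → EReal) (hw : ∀ S T : Finset (Fin n), S ⊆ T → w S ≤ w T)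
    (m : ℕ → EReal) (hm : ∀ s t, s ≤ t → t ≤ n → m s ≤ m t)
    (hwm : ∀ S : Finset (Fin n), w S = m S.card)
    (Y : Ω → EReal) (hY : ∀ ω, Y ω = ⨆ S : Finset (Fin n), (w S ⊓ ⨅ i ∈ S, X i ω))
    (y : EReal) :
    1 - (ℙ {ω | Y ω ≤ y}).toReal =
      ∑ s ∈ Finset.range (n + 1),
        (if m s > y then (1 : ℝ) else 0) *
          (ℙ {ω | (Finset.univ.filter (fun i => X i ω > y)).card = s}).toReal := by
  have hN := measurable_card_filter_gt hX y
  have hmeas (s : ℕ) : MeasurableSet {ω | (univ.filter fun i => X i ω > y).card = s} :=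
    hN (measurableSet_singleton s)
  have hset : {ω | Y ω ≤ y}ᶜ = ⋃ s ∈ (range (n + 1)).filter (fun s => m s > y),
      {ω | (univ.filter fun i => X i ω > y).card = s} := by
    ext ω
    have hcard : (univ.filter fun i => X i ω > y).card < n + 1 :=
      Nat.lt_succ_of_le ((card_le_univ _).trans_eq (Fintype.card_fin n))
    have hlt := lt_iSup_inf_iInf_iff (fun S T h => hw S T h) (fun i => X i ω) y
    rw [← hY, hwm] at hlt
    simp only [Set.mem_compl_iff, Set.mem_ofPred_eq, not_le, hlt, Set.mem_iUnion, mem_filter,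
      mem_range, exists_prop, exists_eq_right', hcard, true_and, gt_iff_lt]
  have hYm : MeasurableSet {ω | Y ω ≤ y} := by
    rw [← MeasurableSet.compl_iff, hset]
    exact Finset.measurableSet_biUnion _ fun s _ => hmeas s
  have hdisj : Set.PairwiseDisjoint (((range (n + 1)).filter (fun s => m s > y) : Finset ℕ) : Set ℕ)
      fun s => {ω | (univ.filter fun i => X i ω > y).card = s} := by
    intro s _ t _ hst
    exact Set.disjoint_left.2 fun ω hs ht => hst (hs.symm.trans ht)
  simp only [← measureReal_def]
  rw [← probReal_compl_eq_one_sub hYm, hset,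
    measureReal_biUnion_finset hdisj fun s _ => hmeas s, sum_filter]
  simp only [ite_mul, one_mul, zero_mul]
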